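/- arXiv:2011.08522 — 2 statements merged into one kernel-verified Lean document; each statement's English description precedes it below -/
import Mathlib

section
/- Let t, t' ∈ B_n with t ≠ t', and let G be a digraph such that the graph algebra A(G) satisfies the identity t ≈ t'. Assume that u and w are vertices belonging to the same block of a nontrivial strongly connected component of G that is a whirl. If u → v_0 → v_1 → ⋯ → v_{Z_{t,t'}} is a walk in G, then (w, v_0) is an edge of G. -/
open Classical

/-- Bracketings of size `n`: binary terms in which `x_1, …, x_n` occur
exactly once, in this order. -/
inductive Bracketing : ℕ → Type
  | leaf : Bracketing 1
  | node : {m k : ℕ} → Bracketing m → Bracketing k → Bracketing (m + k)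

/-- The `n`-ary term operation induced by a bracketing on a groupoid `(α, mul)`. -/
def Bracketing.eval {α : Type*} (mul : α → α → α) : {n : ℕ} → Bracketing n → (Fin n → α) → α
  | _, .leaf, f => f ⟨0, Nat.one_pos⟩
  | _, .node l r, f =>
      mul (Bracketing.eval mul l fun i => f (Fin.castAdd _ i))
          (Bracketing.eval mul r fun i => f (Fin.natAdd _ i))

/-- The multiplication of the graph algebra `A(G)` of a digraph `G = (V, E)`;
`none` plays the role of `∞`. -/
noncomputable def gmul {V : Type*} (E : V → V → Prop) : Option V → Option V → Option V
  | some x, some y => if E x y then some x else none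
  | _, _ => none

/-- The graph algebra `A(G)` satisfies the bracketing identity `t ≈ t'`. -/
def GASat {V : Type*} (E : V → V → Prop) {n : ℕ} (t t' : Bracketing n) : Prop :=
  ∀ f : Fin n → Option V, t.eval (gmul E) f = t'.eval (gmul E) f

/-- `s_n(A(G))`: the number of distinct `n`-ary term operations induced by
bracketings of size `n` on the graph algebra of `(V, E)`. -/
noncomputable def assocSpectrum {V : Type*} (E : V → V → Prop) (n : ℕ) : ℕ :=
  Nat.card (Set.range fun t : Bracketing n => fun f : Fin n → Option V => t.eval (gmul E) f)

/-- Depth sequences of DFS trees (zag sequences): `d(x_1) = 0` and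
`1 ≤ d(x_{i+1}) ≤ d(x_i) + 1`.  DFS trees of size `n` are in bijection with
such sequences. -/
def IsZag (n : ℕ) (d : Fin n → ℕ) : Prop :=
  (∀ h : 0 < n, d ⟨0, h⟩ = 0) ∧
  ∀ (i : ℕ) (h : i + 1 < n),
    1 ≤ d ⟨i + 1, h⟩ ∧ d ⟨i + 1, h⟩ ≤ d ⟨i, Nat.lt_of_succ_lt h⟩ + 1

/-- `j` is the parent of `i` in the DFS tree with depth sequence `d`:
the largest index below `i` whose depth is `d i - 1`. -/
def isParent {n : ℕ} (d : Fin n → ℕ) (j i : Fin n) : Prop :=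
  j < i ∧ d j + 1 = d i ∧ ∀ k : Fin n, j < k → k < i → d k + 1 ≠ d i

/-- `j` is a vertex of the induced subtree rooted at `i` of the DFS tree with
depth sequence `d`. -/
def descend {n : ℕ} (d : Fin n → ℕ) (i j : Fin n) : Prop :=
  i ≤ j ∧ ∀ k : Fin n, i < k → k ≤ j → d i < d k

/-- The induced subtrees rooted at `i` of the DFS trees with depth sequences
`d` and `d'` are equal (same vertex sets and same relative depths). -/
def subtreeEq {n : ℕ} (d d' : Fin n → ℕ) (i : Fin n) : Prop :=
  (∀ j, descend d i j ↔ descend d' i j) ∧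
  ∀ j, descend d i j → d j - d i = d' j - d' i

/-- The height of the induced subtree rooted at `i`. -/
noncomputable def subHeight {n : ℕ} (d : Fin n → ℕ) (i : Fin n) : ℕ :=
  Finset.univ.sup fun j => if descend d i j then d j - d i else 0

/-- The depth sequence of the DFS tree `G(t)` of a bracketing `t`, as a list. -/
def Bracketing.depthList : {n : ℕ} → Bracketing n → List ℕ
  | _, .leaf => [0]
  | _, .node l r => l.depthList ++ r.depthList.map (· + 1)

theorem Bracketing.length_depthList : ∀ {n : ℕ} (t : Bracketing n), t.depthList.length = n
  | _, .leaf => rfl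
  | _, .node l r => by simp [Bracketing.depthList, length_depthList l, length_depthList r]

/-- The depth sequence of the DFS tree `G(t)` of a bracketing `t`. -/
def Bracketing.depth {n : ℕ} (t : Bracketing n) (i : Fin n) : ℕ :=
  t.depthList.get (Fin.cast t.length_depthList.symm i)

/-- The vertex `a` lies on a directed cycle, i.e. it belongs to a nontrivial
strongly connected component. -/
def inCycle {V : Type*} (E : V → V → Prop) (a : V) : Prop :=
  ∃ b, E a b ∧ Relation.ReflTransGen E b a

/-- `a` and `b` are mutually reachable. -/
def sameSCC {V : Type*} (E : V → V → Prop) (a b : V) : Prop :=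
  Relation.ReflTransGen E a b ∧ Relation.ReflTransGen E b a

/-- `K` is a strongly connected component of `(V, E)`. -/
def IsSCC {V : Type*} (E : V → V → Prop) (K : Set V) : Prop :=
  ∃ a, K = {b | sameSCC E a b}

/-- `K` is a nontrivial strongly connected component (contains an edge). -/
def IsNontrivialSCC {V : Type*} (E : V → V → Prop) (K : Set V) : Prop :=
  IsSCC E K ∧ ∃ u ∈ K, ∃ v ∈ K, E u v

/-- `w 0 → w 1 → ⋯ → w ℓ` is a walk in `(V, E)`. -/
def IsWalk {V : Type*} (E : V → V → Prop) (w : ℕ → V) (ℓ : ℕ) : Prop :=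
  ∀ i, i < ℓ → E (w i) (w (i + 1))

/-- `w 0 → ⋯ → w ℓ` is an outlet: `w 0` lies in a nontrivial strongly connected
component and `w 1 → ⋯ → w ℓ` is a pleasant path. -/
def IsOutlet {V : Type*} (E : V → V → Prop) (w : ℕ → V) (ℓ : ℕ) : Prop :=
  IsWalk E w ℓ ∧ inCycle E (w 0) ∧ ∀ i, 1 ≤ i → i ≤ ℓ → ¬ inCycle E (w i)

/-- `K` is an `m`-whirl with block structure `β`: the blocks are the fibres of
`β` (all nonempty), and the edges inside `K` are exactly those from a block to
the cyclically next one. -/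
def IsWhirl {V : Type*} (E : V → V → Prop) (K : Set V) (m : ℕ) (β : V → ZMod m) : Prop :=
  1 ≤ m ∧ (∀ a ∈ K, ∀ b ∈ K, (E a b ↔ β b = β a + 1)) ∧
  ∀ c : ZMod m, ∃ a ∈ K, β a = c

/-- The parameter `Y_{t,t'}`: the largest integer `m` such that all induced
subtrees of height at most `m` of the two DFS trees coincide. -/
noncomputable def Ypar {n : ℕ} (d d' : Fin n → ℕ) : ℤ :=
  sSup {m : ℤ | ∀ i : Fin n,
    ((subHeight d i : ℤ) ≤ m ∨ (subHeight d' i : ℤ) ≤ m) → subtreeEq d d' i}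

/-- The parameter `Z_{t,t'}`: the smallest `m` such that some vertex has equal
induced subtrees of height `m` in the two DFS trees but different parents. -/
noncomputable def Zpar {n : ℕ} (d d' : Fin n → ℕ) : ℕ :=
  sInf {m : ℕ | ∃ i : Fin n, subtreeEq d d' i ∧ subHeight d i = m ∧
    ¬ ∀ j, (isParent d j i ↔ isParent d' j i)}

/-- `R_n`: binary words of length `n` that do not start with `01`, do not end
with `10` and do not contain `101` (with `0 := false`, `1 := true`). -/
def Rset (n : ℕ) : Set (List Bool) :=
  {ρ | ρ.length = n ∧ ¬ [false, true] <+: ρ ∧ ¬ [true, false] <:+ ρ ∧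
    ¬ [true, false, true] <:+: ρ}

/-- The three-element vertex set `{u, v, w}`. -/
inductive V3 : Type | u | v | w

/-- The edge relation of the digraph `G0` with edges `(u,v)`, `(u,w)`, `(w,w)`. -/
def E0 : V3 → V3 → Prop
  | .u, .v => True
  | .u, .w => True
  | .w, .w => True
  | _, _ => False

/-- The edge relation of the induced subgraph on `W`. -/
def inducedE {V : Type*} (E : V → V → Prop) (W : Set V) : ↥W → ↥W → Prop :=
  fun x y => E x.1 y.1

/-- The weakly connected component of `a`. -/
def wcc {V : Type*} (E : V → V → Prop) (a : V) : Set V :=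
  {b | Relation.ReflTransGen (fun x y => E x y ∨ E y x) a b}

/-- The bracketing `x_1 (x_2 x_3)`. -/
def assocL : Bracketing 3 := .node .leaf (.node .leaf .leaf)

/-- The bracketing `(x_1 x_2) x_3`. -/
def assocR : Bracketing 3 := .node (.node .leaf .leaf) .leaf

/-- Left-nested bracketings `((⋯((x_1 x_2) x_3)⋯) x_{n-1}) x_n`. -/
inductive Bracketing.IsLeftNested : {n : ℕ} → Bracketing n → Prop
  | leaf : IsLeftNested .leaf
  | node {n : ℕ} {t : Bracketing n} : IsLeftNested t → IsLeftNested (.node t .leaf)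

/-- The weakly connected component of `a` is associative: its graph algebra
satisfies `x_1 (x_2 x_3) ≈ (x_1 x_2) x_3`. -/
noncomputable def CompAssoc {V : Type*} (E : V → V → Prop) (a : V) : Prop :=
  GASat (inducedE E (wcc E a)) assocL assocR

/-- The weakly connected component of `a` is a directed bipartite graph with at
least one edge. -/
def CompBip {V : Type*} (E : V → V → Prop) (a : V) : Prop :=
  (∃ f : ↥(wcc E a) → Bool, ∀ x y : ↥(wcc E a), inducedE E (wcc E a) x y →
    f x = true ∧ f y = false) ∧ ∃ x y : ↥(wcc E a), inducedE E (wcc E a) x y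

/-- The map `ρ ↦ ρ1 / ρ00 / ρ1000` from `R_{n-1} ⊔ R_{n-2} ⊔ R_{n-4}`. -/
def psi (n : ℕ) : ↥(Rset (n - 1)) ⊕ ↥(Rset (n - 2)) ⊕ ↥(Rset (n - 4)) → List Bool
  | .inl ρ => ρ.1 ++ [true]
  | .inr (.inl ρ) => ρ.1 ++ [false, false]
  | .inr (.inr ρ) => ρ.1 ++ [true, false, false, false]

section Zag

variable {n : ℕ} {d d' : Fin n → ℕ} {i j a b : Fin n}

theorem IsZag.exists_isParent_ge (hd : IsZag n d) (hij : i < j) (h : d i < d j) :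
    ∃ a, i ≤ a ∧ isParent d a j := by
  obtain ⟨a, ha, hmax⟩ := (Finset.univ.filter fun a => a < j ∧ d a < d j).exists_max_image id
    ⟨i, by simp [hij, h]⟩
  simp only [Finset.mem_filter, Finset.mem_univ, true_and, id] at ha hmax
  have hge : ∀ k, a < k → k < j → d j ≤ d k := fun k hak hkj => by
    by_contra! hlt
    exact absurd (hmax k ⟨hkj, hlt⟩) (not_le.2 hak)
  have hlt : (a : ℕ) + 1 < n := lt_of_le_of_lt (Nat.succ_le_of_lt ha.1) j.2
  have hstep : d j ≤ d ⟨a + 1, hlt⟩ := by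
    rcases (Nat.succ_le_of_lt (show (a : ℕ) < j from ha.1)).lt_or_eq with h1 | h1
    · exact hge _ (Nat.lt_succ_self (a : ℕ)) h1
    · exact le_of_eq (congrArg d (Fin.ext h1.symm))
  have hzag := (hd.2 a hlt).2
  have hle : d j ≤ d a + 1 := hstep.trans hzag
  refine ⟨a, hmax i ⟨hij, h⟩, ha.1, by omega, fun k hak hkj => ?_⟩
  have := hge k hak hkj
  omega

theorem IsZag.pos (hd : IsZag n d) (hi : 0 < (i : ℕ)) : 1 ≤ d i := by
  obtain ⟨i, hin⟩ := i
  cases i with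
  | zero => exact absurd hi (lt_irrefl 0)
  | succ i => exact (hd.2 i hin).1

theorem IsZag.exists_isParent (hd : IsZag n d) (hi : 0 < (i : ℕ)) : ∃ a, isParent d a i := by
  have hn : 0 < n := hi.trans i.2
  have h0 := hd.1 hn
  have h1 := hd.pos hi
  obtain ⟨a, -, ha⟩ := hd.exists_isParent_ge (i := ⟨0, hn⟩) (j := i) hi (by omega)
  exact ⟨a, ha⟩

theorem isParent.eq (ha : isParent d a j) (hb : isParent d b j) : a = b := by
  rcases lt_trichotomy a b with h | h | h
  · exact absurd hb.2.1 (ha.2.2 b h hb.1)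
  · exact h
  · exact absurd ha.2.1 (hb.2.2 a h ha.1)

theorem isParent.pos (h : isParent d a i) : 0 < (i : ℕ) :=
  Nat.zero_lt_of_lt h.1

theorem isParent.le_of_between (hd : IsZag n d) (ha : isParent d a j) (hai : a < i) (hij : i < j) :
    d j ≤ d i := by
  by_contra! h
  obtain ⟨b, hib, hb⟩ := hd.exists_isParent_ge hij h
  exact absurd (ha.eq hb) (hai.trans_le hib).ne

theorem descend_self (d : Fin n → ℕ) (i : Fin n) : descend d i i :=
  ⟨le_rfl, fun _ h h' => absurd h (not_lt.2 h')⟩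

theorem descend.le (h : descend d i j) : d i ≤ d j := by
  rcases h.1.lt_or_eq with hlt | rfl
  · exact (h.2 j hlt le_rfl).le
  · exact le_rfl

theorem isParent.descend_iff (hd : IsZag n d) (ha : isParent d a j) (hne : j ≠ i) :
    descend d i j ↔ descend d i a := by
  constructor
  · intro h
    have hij := lt_of_le_of_ne h.1 hne.symm
    obtain ⟨b, hib, hb⟩ := hd.exists_isParent_ge hij (h.2 j hij le_rfl)
    rw [ha.eq hb]
    exact ⟨hib, fun k hik hkb => h.2 k hik (hkb.trans hb.1.le)⟩
  · intro h
    refine ⟨h.1.trans ha.1.le, fun k hik hkj => ?_⟩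
    rcases le_or_gt k a with hka | hak
    · exact h.2 k hik hka
    · have h1 : d j ≤ d k := by
        rcases hkj.lt_or_eq with hkj | rfl
        · exact ha.le_of_between hd hak hkj
        · exact le_rfl
      have := h.le
      have := ha.2.1
      omega

theorem le_subHeight (h : descend d i j) : d j - d i ≤ subHeight d i := by
  refine le_trans (le_of_eq ?_)
    (Finset.le_sup (f := fun j => if descend d i j then d j - d i else 0) (Finset.mem_univ j))
  exact (if_pos h).symm

theorem subtreeEq_of_isParent_iff (hd : IsZag n d) (hd' : IsZag n d')
    (h : ∀ j, i < j → ∀ a, isParent d a j ↔ isParent d' a j) : subtreeEq d d' i := by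
  suffices H : ∀ j, (descend d i j ↔ descend d' i j) ∧
      (descend d i j → d j - d i = d' j - d' i) from
    ⟨fun j => (H j).1, fun j => (H j).2⟩
  intro j
  induction j using WellFoundedLT.induction with
  | ind j ih =>
    rcases lt_trichotomy i j with hij | rfl | hji
    · obtain ⟨a, ha⟩ := hd.exists_isParent (i := j) (Nat.zero_lt_of_lt hij)
      have ha' := (h j hij a).1 ha
      rw [ha.descend_iff hd hij.ne', ha'.descend_iff hd' hij.ne']
      refine ⟨(ih a ha.1).1, fun hia => ?_⟩
      have h1 := (ih a ha.1).2 hia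
      have h2 := hia.le
      have h3 := ((ih a ha.1).1.1 hia).le
      have h4 := ha.2.1
      have h5 := ha'.2.1
      omega
    · simp [descend_self]
    · have h1 : ¬ descend d i j := fun h => absurd hji (not_lt.2 h.1)
      have h2 : ¬ descend d' i j := fun h => absurd hji (not_lt.2 h.1)
      simp [h1, h2]

theorem IsZag.eq_of_isParent_iff (hd : IsZag n d) (hd' : IsZag n d')
    (h : ∀ j a, isParent d a j ↔ isParent d' a j) : d = d' := by
  funext j
  induction j using WellFoundedLT.induction with
  | ind j ih =>
    rcases Nat.eq_zero_or_pos j with hj | hj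
    · have hn : 0 < n := j.pos
      obtain rfl : j = ⟨0, hn⟩ := Fin.ext hj
      rw [hd.1 hn, hd'.1 hn]
    · obtain ⟨a, ha⟩ := hd.exists_isParent hj
      have ha' := (h j a).1 ha
      rw [← ha.2.1, ← ha'.2.1, ih a ha.1]

/-- If two DFS trees differ, then the infimum defining `Zpar` is attained. -/
theorem exists_subHeight_eq_Zpar (hd : IsZag n d) (hd' : IsZag n d') (hne : d ≠ d') :
    ∃ i, subtreeEq d d' i ∧ subHeight d i = Zpar d d' ∧
      ¬ ∀ a, (isParent d a i ↔ isParent d' a i) := by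
  have hex : ∃ j, ¬ ∀ a, (isParent d a j ↔ isParent d' a j) := by
    by_contra! h
    exact hne (hd.eq_of_isParent_iff hd' h)
  obtain ⟨j, hj⟩ := hex
  obtain ⟨i, hi, hmax⟩ := (Finset.univ.filter fun j =>
    ¬ ∀ a, (isParent d a j ↔ isParent d' a j)).exists_max_image id
      ⟨j, Finset.mem_filter.2 ⟨Finset.mem_univ j, hj⟩⟩
  have hi := (Finset.mem_filter.1 hi).2
  refine Nat.sInf_mem (s := {m : ℕ | ∃ i : Fin n, subtreeEq d d' i ∧ subHeight d i = m ∧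
    ¬ ∀ j, (isParent d j i ↔ isParent d' j i)}) ⟨_, i, ?_, rfl, hi⟩
  refine subtreeEq_of_isParent_iff hd hd' fun k hik => ?_
  by_contra hk
  exact absurd (hmax k (Finset.mem_filter.2 ⟨Finset.mem_univ k, hk⟩)) (not_le.2 hik)

/-- A vertex whose parents are not the same in the two DFS trees has two distinct parents. -/
theorem exists_distinct_parents (hd : IsZag n d) (hd' : IsZag n d')
    (h : ¬ ∀ a, (isParent d a i ↔ isParent d' a i)) :
    ∃ p q, isParent d p i ∧ isParent d' q i ∧ p ≠ q := by
  obtain ⟨j, hj⟩ := not_forall.1 h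
  by_cases hjd : isParent d j i
  · have hjd' : ¬ isParent d' j i := fun hjd' => hj (iff_of_true hjd hjd')
    obtain ⟨q, hq⟩ := hd'.exists_isParent hjd.pos
    exact ⟨j, q, hjd, hq, fun e => hjd' (e ▸ hq)⟩
  · have hjd' : isParent d' j i := by
      by_contra hjd'
      exact hj (iff_of_false hjd hjd')
    obtain ⟨p, hp⟩ := hd.exists_isParent hjd'.pos
    exact ⟨p, j, hp, hjd', fun e => hjd (e ▸ hp)⟩

end Zag

theorem List.eq_of_append_cons_eq_append_cons {α : Type*} {x : α} {a a' s s' : List α}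
    (hs : x ∉ s) (hs' : x ∉ s') (h : a ++ x :: s = a' ++ x :: s') : a = a' ∧ s = s' := by
  induction a generalizing a' with
  | nil =>
    cases a' with
    | nil => exact ⟨rfl, (List.cons.inj h).2⟩
    | cons y a' =>
      obtain ⟨-, rfl⟩ := List.cons.inj h
      exact absurd (by simp) hs
  | cons y a ih =>
    cases a' with
    | nil =>
      obtain ⟨-, rfl⟩ := List.cons.inj h
      exact absurd (by simp) hs'
    | cons z a' =>
      obtain ⟨rfl, htail⟩ := List.cons.inj h
      obtain ⟨rfl, rfl⟩ := ih htail
      exact ⟨rfl, rfl⟩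

namespace Bracketing

theorem size_pos : ∀ {n : ℕ}, Bracketing n → 0 < n
  | _, .leaf => Nat.one_pos
  | _, .node l _ => Nat.add_pos_left l.size_pos _

theorem depth_leaf (i : Fin 1) : leaf.depth i = 0 := by
  simp [depth, depthList]

variable {m k : ℕ} (l : Bracketing m) (r : Bracketing k)

theorem depth_node_castAdd (i : Fin m) : (node l r).depth (Fin.castAdd k i) = l.depth i := by
  have h : (i : ℕ) < l.depthList.length := l.length_depthList.symm ▸ i.2
  exact List.getElem_append_left h

theorem depth_node_natAdd (i : Fin k) : (node l r).depth (Fin.natAdd m i) = r.depth i + 1 := by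
  have h : l.depthList.length ≤ m + i := l.length_depthList.symm ▸ Nat.le_add_right m i
  refine (List.getElem_append_right h).trans ?_
  simp [depth, l.length_depthList]

theorem isZag_depth : ∀ {n : ℕ} (t : Bracketing n), IsZag n t.depth
  | _, .leaf => ⟨fun _ => depth_leaf _, fun i h => by omega⟩
  | _, .node (m := m) (k := k) l r => by
    have hl := isZag_depth l
    have hr := isZag_depth r
    refine ⟨fun _ => (depth_node_castAdd l r ⟨0, l.size_pos⟩).trans (hl.1 _), fun i h => ?_⟩
    rcases lt_trichotomy (i + 1) m with him | him | him
    · have h1 := depth_node_castAdd l r ⟨i + 1, him⟩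
      have h2 := depth_node_castAdd l r ⟨i, Nat.lt_of_succ_lt him⟩
      simp only [Fin.castAdd_mk] at h1 h2
      rw [h1, h2]
      exact hl.2 i him
    · have h1 := depth_node_natAdd l r ⟨0, r.size_pos⟩
      rw [hr.1] at h1
      have e : (⟨i + 1, h⟩ : Fin (m + k)) = Fin.natAdd m ⟨0, r.size_pos⟩ := Fin.ext him
      rw [e, h1]
      omega
    · obtain ⟨c, rfl⟩ : ∃ c, i = m + c := ⟨i - m, by omega⟩
      have hc : c + 1 < k := by omega
      have h1 := depth_node_natAdd l r ⟨c + 1, hc⟩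
      have h2 := depth_node_natAdd l r ⟨c, Nat.lt_of_succ_lt hc⟩
      simp only [Fin.natAdd_mk, ← add_assoc] at h1 h2
      rw [h1, h2]
      have := hr.2 c hc
      omega

theorem isParent_node_castAdd_castAdd {a b : Fin m} :
    isParent (node l r).depth (Fin.castAdd k a) (Fin.castAdd k b) ↔ isParent l.depth a b := by
  simp only [isParent, depth_node_castAdd]
  refine and_congr Iff.rfl (and_congr Iff.rfl ⟨fun h c hac hcb => ?_, fun h c => ?_⟩)
  · simpa only [depth_node_castAdd] using h (Fin.castAdd k c) hac hcb
  · induction c using Fin.addCases with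
    | left c =>
      rw [depth_node_castAdd]
      exact h c
    | right c =>
      intro _ hcb
      have := b.2
      simp only [Fin.lt_def, Fin.val_natAdd, Fin.val_castAdd] at hcb
      omega

theorem isParent_node_natAdd_natAdd {a b : Fin k} :
    isParent (node l r).depth (Fin.natAdd m a) (Fin.natAdd m b) ↔ isParent r.depth a b := by
  simp only [isParent, depth_node_natAdd, Nat.add_right_cancel_iff]
  refine and_congr (by simp) (and_congr Iff.rfl ⟨fun h c hac hcb => ?_, fun h c => ?_⟩)
  · simpa [depth_node_natAdd] using h (Fin.natAdd m c) (by simpa using hac) (by simpa using hcb)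
  · induction c using Fin.addCases with
    | left c =>
      intro hac
      have := c.2
      simp only [Fin.lt_def, Fin.val_natAdd, Fin.val_castAdd] at hac
      omega
    | right c => simpa [depth_node_natAdd] using h c

theorem isParent_node_castAdd_natAdd {a : Fin m} {b : Fin k} :
    isParent (node l r).depth (Fin.castAdd k a) (Fin.natAdd m b) ↔
      a = ⟨0, l.size_pos⟩ ∧ b = ⟨0, r.size_pos⟩ := by
  constructor
  · intro h
    have hb : b = ⟨0, r.size_pos⟩ := by
      by_contra hb
      obtain ⟨c, hc⟩ := r.isZag_depth.exists_isParent (i := b)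
        (Nat.pos_of_ne_zero fun e => hb (Fin.ext e))
      have e := h.eq ((isParent_node_natAdd_natAdd l r).2 hc)
      have hval := congrArg Fin.val e
      have := a.2
      simp only [Fin.val_natAdd, Fin.val_castAdd] at hval
      omega
    subst hb
    refine ⟨?_, rfl⟩
    have h1 := h.2.1
    rw [depth_node_castAdd, depth_node_natAdd, r.isZag_depth.1] at h1
    by_contra ha
    have := l.isZag_depth.pos (i := a) (Nat.pos_of_ne_zero fun e => ha (Fin.ext e))
    omega
  · rintro ⟨rfl, rfl⟩
    refine ⟨?_, ?_, fun c => ?_⟩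
    · exact Nat.add_pos_left l.size_pos 0
    · rw [depth_node_castAdd, depth_node_natAdd, r.isZag_depth.1, l.isZag_depth.1]
    · rw [depth_node_natAdd, r.isZag_depth.1]
      induction c using Fin.addCases with
      | left c =>
        intro h _
        rw [depth_node_castAdd]
        have := l.isZag_depth.pos (i := c) h
        omega
      | right c =>
        intro _ h
        simp only [Fin.lt_def, Fin.val_natAdd] at h
        omega

theorem not_isParent_node_natAdd_castAdd {a : Fin k} {b : Fin m} :
    ¬ isParent (node l r).depth (Fin.natAdd m a) (Fin.castAdd k b) := by
  intro h
  have := h.1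
  have := b.2
  simp only [Fin.lt_def, Fin.val_natAdd, Fin.val_castAdd] at *
  omega

/-- In a graph algebra, a bracketing evaluated at a tuple of vertices takes a vertex as its value
exactly when the tuple is a homomorphism from the DFS tree, and that value is the image of the
root. -/
theorem eval_gmul_eq_some_iff {V : Type*} (E : V → V → Prop) :
    ∀ {n : ℕ} (t : Bracketing n) (f : Fin n → V) (y : V),
      t.eval (gmul E) (fun i => some (f i)) = some y ↔
        y = f ⟨0, t.size_pos⟩ ∧ ∀ a b, isParent t.depth a b → E (f a) (f b)
  | _, .leaf, f, y => by
    have h : ∀ a b, ¬ isParent leaf.depth a b := fun a b h => by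
      have := h.1
      omega
    simp [eval, h, eq_comm]
  | _, .node (m := m) (k := k) l r, f, y => by
    have hl := eval_gmul_eq_some_iff E l (fun i => f (Fin.castAdd k i))
    have hr := eval_gmul_eq_some_iff E r (fun i => f (Fin.natAdd m i))
    have hmul : ∀ p q : Option V, gmul E p q = some y ↔ p = some y ∧ ∃ z, q = some z ∧ E y z := by
      rintro (_ | p) (_ | q)
      · simp [gmul]
      · simp [gmul]
      · simp [gmul]
      · by_cases h : E p q
        · simp only [gmul, h, if_true, Option.some.injEq, exists_eq_left']
          exact ⟨fun e => ⟨e, e ▸ h⟩, And.left⟩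
        · simp only [gmul, h, if_false, Option.some.injEq, exists_eq_left', reduceCtorEq, false_iff]
          rintro ⟨rfl, h'⟩
          exact h h'
    rw [eval, hmul, hl]
    simp only [hr, Fin.forall_fin_add, isParent_node_castAdd_castAdd,
      isParent_node_natAdd_natAdd, isParent_node_castAdd_natAdd, not_isParent_node_natAdd_castAdd]
    have h0 : (⟨0, (node l r).size_pos⟩ : Fin (m + k)) = Fin.castAdd k ⟨0, l.size_pos⟩ := rfl
    rw [h0]
    constructor
    · rintro ⟨⟨rfl, hA⟩, z, ⟨rfl, hB⟩, hC⟩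
      refine ⟨rfl, fun a => ⟨hA a, ?_⟩, fun a => ⟨fun _ h => h.elim, hB a⟩⟩
      rintro b ⟨rfl, rfl⟩
      exact hC
    · rintro ⟨rfl, hA, hB⟩
      exact ⟨⟨rfl, fun a => (hA a).1⟩, _, ⟨rfl, fun a => (hB a).2⟩, (hA _).2 _ ⟨rfl, rfl⟩⟩

/-- The graph algebra identity `t ≈ t'` turns homomorphisms from the first DFS tree into
homomorphisms from the second one. -/
theorem _root_.GASat.hom {V : Type*} {E : V → V → Prop} {n : ℕ} {t t' : Bracketing n}
    (h : GASat E t t') {f : Fin n → V} (hf : ∀ a b, isParent t.depth a b → E (f a) (f b)) :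
    ∀ a b, isParent t'.depth a b → E (f a) (f b) :=
  ((eval_gmul_eq_some_iff E t' f _).1
    ((h _).symm.trans ((eval_gmul_eq_some_iff E t f _).2 ⟨rfl, hf⟩))).2

theorem exists_depthList_eq_cons : ∀ {n : ℕ} (t : Bracketing n), ∃ s,
    t.depthList = 0 :: s ∧ ∀ x ∈ s, 1 ≤ x
  | _, .leaf => ⟨[], rfl, by simp⟩
  | _, .node l r => by
    obtain ⟨s, hs, hs1⟩ := exists_depthList_eq_cons l
    refine ⟨s ++ r.depthList.map (· + 1), by rw [depthList, hs, List.cons_append], ?_⟩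
    intro x hx
    rcases List.mem_append.1 hx with hx | hx
    · exact hs1 x hx
    · obtain ⟨y, -, rfl⟩ := List.mem_map.1 hx
      omega

theorem depthList_injective : ∀ {n n' : ℕ} (t : Bracketing n) (t' : Bracketing n'),
    t.depthList = t'.depthList → (⟨n, t⟩ : Σ n, Bracketing n) = ⟨n', t'⟩
  | _, _, .leaf, .leaf, _ => rfl
  | _, _, .leaf, .node l r, h => by
    have h1 := congrArg List.length h
    rw [length_depthList, length_depthList] at h1
    have := l.size_pos
    have := r.size_pos
    omega
  | _, _, .node l r, .leaf, h => by
    have h1 := congrArg List.length h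
    rw [length_depthList, length_depthList] at h1
    have := l.size_pos
    have := r.size_pos
    omega
  | _, _, .node l r, .node l' r', h => by
    obtain ⟨s, hs, hs1⟩ := exists_depthList_eq_cons r
    obtain ⟨s', hs', hs1'⟩ := exists_depthList_eq_cons r'
    rw [depthList, depthList, hs, hs', List.map_cons, List.map_cons] at h
    have hnot : ∀ s : List ℕ, (∀ x ∈ s, 1 ≤ x) → 0 + 1 ∉ s.map (· + 1) := by
      intro s hs hmem
      obtain ⟨y, hy, hy1⟩ := List.mem_map.1 hmem
      have := hs y hy
      omega
    obtain ⟨h1, h2⟩ := List.eq_of_append_cons_eq_append_cons (hnot s hs1) (hnot s' hs1') h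
    have h3 : s = s' := List.map_injective_iff.2 (add_left_injective 1) h2
    cases depthList_injective l l' h1
    cases depthList_injective r r' (by rw [hs, hs', h3])
    rfl

theorem depth_injective {n : ℕ} {t t' : Bracketing n} (h : t.depth = t'.depth) : t = t' := by
  have hlist : t.depthList = t'.depthList := by
    refine List.ext_getElem (by rw [length_depthList, length_depthList]) fun i h1 h2 => ?_
    exact congrFun h ⟨i, t.length_depthList ▸ h1⟩
  exact eq_of_heq (Sigma.mk.inj (depthList_injective t t' hlist)).2

end Bracketing

/-- If a graph algebra whose digraph contains an `m`-whirl satisfies `t ≈ t'`, then depths in the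
two DFS trees agree modulo `m`. -/
theorem GASat.depth_cast_eq {V : Type*} {E : V → V → Prop} {n : ℕ} {t t' : Bracketing n}
    (hsat : GASat E t t') {K : Set V} {m : ℕ} {β : V → ZMod m} (hwhirl : IsWhirl E K m β)
    (i : Fin n) : (t.depth i : ZMod m) = t'.depth i := by
  choose rep hrepK hrep using hwhirl.2.2
  have hom := hsat.hom (f := fun x => rep (t.depth x)) fun a b hab => by
    rw [hwhirl.2.1 _ (hrepK _) _ (hrepK _), hrep, hrep, ← hab.2.1, Nat.cast_succ]
  induction i using WellFoundedLT.induction with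
  | ind i ih =>
    rcases Nat.eq_zero_or_pos i with hi | hi
    · obtain rfl : i = ⟨0, t.size_pos⟩ := Fin.ext hi
      rw [t.isZag_depth.1, t'.isZag_depth.1]
    · obtain ⟨a, ha⟩ := t'.isZag_depth.exists_isParent hi
      have h := hom a i ha
      rw [hwhirl.2.1 _ (hrepK _) _ (hrepK _), hrep, hrep] at h
      rw [h, ih a ha.1, ← ha.2.1, Nat.cast_succ]

/-- Lemma 7.13: if the graph algebra of `(V, E)` satisfies a
nontrivial bracketing identity `t ≈ t'`, `u` and `w` lie in the same block of a
nontrivial strongly connected component `K` that is a whirl, and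
`u → v 0 → v 1 → ⋯ → v Z` is a walk (`Z = Z_{t,t'}`), then `(w, v 0)` is an
edge. -/
theorem edge_of_same_block_and_walk {V : Type*} (E : V → V → Prop) {n : ℕ}
    (t t' : Bracketing n) (hne : t ≠ t') (hsat : GASat E t t')
    (K : Set V) (hK : IsNontrivialSCC E K)
    (m : ℕ) (β : V → ZMod m) (hwhirl : IsWhirl E K m β)
    (u w : V) (hu : u ∈ K) (hw : w ∈ K) (hblock : β u = β w)
    (v : ℕ → V) (huv : E u (v 0)) (hwalk : IsWalk E v (Zpar t.depth t'.depth)) :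
    E w (v 0) := by
  have hd := t.isZag_depth
  have hd' := t'.isZag_depth
  obtain ⟨i, -, hheight, hpar⟩ := exists_subHeight_eq_Zpar hd hd'
    fun h => hne (Bracketing.depth_injective h)
  obtain ⟨p, q, hp, hq, hpq⟩ := exists_distinct_parents hd hd' hpar
  have hqp : (t.depth q : ZMod m) = t.depth p := by
    have hi := hsat.depth_cast_eq hwhirl i
    rw [← hp.2.1, ← hq.2.1, Nat.cast_succ, Nat.cast_succ, ← hsat.depth_cast_eq hwhirl q] at hi
    exact (add_right_cancel hi).symm
  choose rep hrepK hrep using hwhirl.2.2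
  let g : Fin n → V := fun x =>
    if x = p then u else if x = q then w else rep (β u + (t.depth x - t.depth p))
  have hgK : ∀ x, g x ∈ K := fun x => by
    simp only [g]
    split_ifs
    exacts [hu, hw, hrepK _]
  have hgβ : ∀ x, β (g x) = β u + (t.depth x - t.depth p) := fun x => by
    simp only [g]
    split_ifs with h1 h2
    · rw [h1, sub_self, add_zero]
    · rw [h2, hqp, sub_self, add_zero, hblock]
    · exact hrep _
  have hgE : ∀ a b, isParent t.depth a b → E (g a) (g b) := fun a b hab => by
    rw [hwhirl.2.1 _ (hgK a) _ (hgK b), hgβ, hgβ, ← hab.2.1, Nat.cast_succ]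
    ring
  have hnot : ∀ {x}, x < i → ¬ descend t.depth i x := fun hx h => absurd hx (not_lt.2 h.1)
  have hom := hsat.hom
    (f := fun x => if descend t.depth i x then v (t.depth x - t.depth i) else g x)
    fun a b hab => by
      by_cases hbi : b = i
      · subst hbi
        obtain rfl := hab.eq hp
        rw [if_neg (hnot hp.1), if_pos (descend_self _ _), Nat.sub_self]
        simpa only [g, if_true] using huv
      · have hiff := hab.descend_iff hd hbi
        by_cases hb : descend t.depth i b
        · have ha := hiff.1 hb
          have hle := ha.le
          have hsucc := hab.2.1
          have hbound := le_subHeight hb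
          rw [if_pos hb, if_pos ha,
            show t.depth b - t.depth i = t.depth a - t.depth i + 1 by omega]
          exact hwalk _ (by omega)
        · rw [if_neg hb, if_neg (hb ∘ hiff.2)]
          exact hgE a b hab
  have hedge := hom q i hq
  rw [if_neg (hnot hq.1), if_pos (descend_self _ _), Nat.sub_self] at hedge
  simpa only [g, if_neg hpq.symm, if_true] using hedge
end

section
/- Let G0 be the digraph with vertex set {u,v,w} and edge set {(u,v),(u,w),(w,w)}. The associative spectrum of the graph algebra A(G0) satisfies s_n = |R_{n−1}| for all n ≥ 3. -/
open Classical

/-- The word recording which of `x_2, …, x_n` are leaves of depth one in the DFS tree of `t`. -/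
def Bracketing.leafWord : {n : ℕ} → Bracketing n → List Bool
  | _, .leaf => []
  | _, .node (k := k) l _ => l.leafWord ++ List.replicate k (decide (k = 1))

theorem Bracketing.pos {n : ℕ} (t : Bracketing n) : 0 < n := by
  induction t <;> omega

theorem Bracketing.length_leafWord {n : ℕ} (t : Bracketing n) : t.leafWord.length + 1 = n := by
  induction t with
  | leaf => rfl
  | node l r ihl ihr => simp [leafWord]; omega

theorem gmul_E0_eq_w {a b : Option V3} :
    gmul E0 a b = some .w ↔ a = some .w ∧ b = some .w := by
  rcases a with _ | _ | _ | _ <;> rcases b with _ | _ | _ | _ <;> simp [gmul, E0]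

theorem gmul_E0_ne_v {a b : Option V3} : gmul E0 a b ≠ some .v := by
  rcases a with _ | _ | _ | _ <;> rcases b with _ | _ | _ | _ <;> simp [gmul, E0]

theorem gmul_E0_eq_u {a b : Option V3} :
    gmul E0 a b = some .u ↔ a = some .u ∧ (b = some .v ∨ b = some .w) := by
  rcases a with _ | _ | _ | _ <;> rcases b with _ | _ | _ | _ <;> simp [gmul, E0]

theorem Bracketing.eval_eq_w {n : ℕ} (t : Bracketing n) (f : Fin n → Option V3) :
    t.eval (gmul E0) f = some .w ↔ ∀ i, f i = some .w := by
  induction t with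
  | leaf => simp [eval, Fin.forall_fin_one]
  | node l r ihl ihr => simp only [eval, gmul_E0_eq_w, ihl, ihr, Fin.forall_fin_add]

theorem Bracketing.eval_eq_v {n : ℕ} (t : Bracketing n) (f : Fin n → Option V3) :
    t.eval (gmul E0) f = some .v ↔ n = 1 ∧ ∀ i, f i = some .v := by
  cases t with
  | leaf => simp [eval, Fin.forall_fin_one]
  | node l r =>
    have := l.pos
    have := r.pos
    simp only [eval, gmul_E0_ne_v, false_iff]
    omega

theorem Bracketing.eval_eq_u {n : ℕ} (t : Bracketing n) (f : Fin n → Option V3) :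
    t.eval (gmul E0) f = some .u ↔ f ⟨0, t.pos⟩ = some .u ∧ ∀ (i : ℕ) (h : i + 1 < n),
      f ⟨i + 1, h⟩ = some .w ∨ f ⟨i + 1, h⟩ = some .v ∧ t.leafWord[i]? = some true := by
  induction t with
  | leaf => simp [eval]
  | @node m k l r ihl ihr =>
    have hl := l.length_leafWord
    have hr := r.pos
    simp only [eval, gmul_E0_eq_u, ihl, eval_eq_w, eval_eq_v, and_assoc, leafWord]
    refine and_congr Iff.rfl ⟨?_, ?_⟩
    · rintro ⟨h₁, h₂⟩ i hi
      by_cases him : i + 1 < m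
      · have := h₁ i him
        rwa [List.getElem?_append_left (by omega)]
      · have hnat (P : Option V3 → Prop) (hP : ∀ j : Fin k, P (f (Fin.natAdd m j))) :
            P (f ⟨i + 1, hi⟩) := by
          convert hP ⟨i + 1 - m, by omega⟩ using 2
          ext
          simp
          omega
        rcases h₂ with ⟨rfl, h₂⟩ | h₂
        · refine .inr ⟨hnat (· = some .v) h₂, ?_⟩
          rw [List.getElem?_append_right (by omega), List.getElem?_replicate]
          simp
          omega
        · exact .inl (hnat (· = some .w) h₂)
    · intro h
      refine ⟨fun i hi => ?_, ?_⟩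
      · have := h i (by omega)
        rwa [List.getElem?_append_left (by omega)] at this
      · have hnat (j : Fin k) := h (m + j - 1) (by omega)
        have hidx (j : Fin k) (hj : m + j - 1 + 1 < m + k) :
            (⟨m + j - 1 + 1, hj⟩ : Fin (m + k)) = Fin.natAdd m j := by
          ext
          simp
          omega
        simp only [hidx] at hnat
        by_cases hk : k = 1
        · subst hk
          simp only [Fin.forall_fin_one] at hnat ⊢
          tauto
        · refine .inr fun j => (hnat j).resolve_right fun hj => ?_
          have := hj.2
          rw [List.getElem?_append_right (by omega), List.getElem?_replicate] at this
          simp [hk] at this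

theorem Bracketing.eval_eq_iff_leafWord_eq {n : ℕ} (t t' : Bracketing n) :
    t.eval (gmul E0) = t'.eval (gmul E0) ↔ t.leafWord = t'.leafWord := by
  have hl := t.length_leafWord
  have hl' := t'.length_leafWord
  constructor
  · intro h
    have key (s : Bracketing n) (i : ℕ) (hi : i + 1 < n) :
        s.eval (gmul E0) (fun j => if j.1 = 0 then some .u else if j.1 = i + 1 then some .v
          else some .w) = some .u ↔ s.leafWord[i]? = some true := by
      rw [eval_eq_u]
      constructor
      · rintro ⟨-, h⟩
        simpa using h i hi
      · refine fun h => ⟨by simp, fun j hj => ?_⟩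
        by_cases hij : j = i <;> simp_all
    refine List.ext_getElem (by omega) fun i hi hi' => ?_
    have := (key t i (by omega)).symm.trans (h ▸ key t' i (by omega))
    rw [List.getElem?_eq_getElem hi, List.getElem?_eq_getElem hi'] at this
    exact Bool.eq_iff_iff.2 (by simpa using this)
  · intro h
    funext f
    refine Option.ext fun a => ?_
    cases a with
    | u => rw [eval_eq_u, eval_eq_u, h]
    | v => rw [eval_eq_v, eval_eq_v]
    | w => rw [eval_eq_w, eval_eq_w]

/-- Every `0` in the word `ρ` is adjacent to another `0`. -/
def NoIsolatedZero (ρ : List Bool) : Prop :=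
  ∀ i, ρ[i]? = some false → ρ[i + 1]? = some false ∨ ∃ j, j + 1 = i ∧ ρ[j]? = some false

theorem Bracketing.noIsolatedZero_leafWord {n : ℕ} (t : Bracketing n) :
    NoIsolatedZero t.leafWord := by
  induction t with
  | leaf => simp [NoIsolatedZero, leafWord]
  | @node m k l r ihl ihr =>
    intro i hi
    simp only [leafWord, List.getElem?_append, List.getElem?_replicate] at hi ⊢
    by_cases h : i < l.leafWord.length
    · rw [if_pos h] at hi
      rcases ihl i hi with h' | ⟨j, rfl, h'⟩
      · have := (List.getElem?_eq_some_iff.1 h').1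
        exact .inl (by rw [if_pos this, h'])
      · refine .inr ⟨j, rfl, ?_⟩
        rw [if_pos (by omega), h']
    · by_cases h1 : i + 1 - l.leafWord.length < k
      · grind
      · refine .inr ⟨i - 1, ?_⟩
        grind

theorem NoIsolatedZero.exists_leafWord_eq (n : ℕ) (ρ : List Bool) (hn : ρ.length + 1 = n)
    (h : NoIsolatedZero ρ) : ∃ t : Bracketing n, t.leafWord = ρ := by
  induction n using Nat.strong_induction_on generalizing ρ with
  | _ n ih =>
    rcases List.eq_nil_or_concat' ρ with rfl | ⟨ρ, b, rfl⟩
    · obtain rfl : n = 1 := by simpa using hn.symm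
      exact ⟨.leaf, rfl⟩
    cases b with
    | true =>
      obtain ⟨m, rfl⟩ : ∃ m, n = m + 1 := ⟨ρ.length + 1, by simpa using hn.symm⟩
      obtain ⟨t, rfl⟩ := ih m (by omega) ρ (by simpa using hn) fun i hi => by
        have h0 := h i
        have h1 := (List.getElem?_eq_some_iff.1 hi).1
        grind
      exact ⟨.node t .leaf, rfl⟩
    | false =>
      rcases List.eq_nil_or_concat' ρ with rfl | ⟨ρ, b, rfl⟩
      · simpa using h 0
      obtain rfl : b = false := by
        have := h (ρ.length + 1)
        grind
      by_cases hρ : NoIsolatedZero ρ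
      · obtain ⟨m, rfl⟩ : ∃ m, n = m + 2 := ⟨ρ.length + 1, by simpa using hn.symm⟩
        obtain ⟨t, rfl⟩ := ih m (by omega) ρ (by simpa using hn) hρ
        exact ⟨.node t (.node .leaf .leaf), by simp [Bracketing.leafWord]⟩
      · rcases List.eq_nil_or_concat' ρ with rfl | ⟨ρ, b, rfl⟩
        · simp [NoIsolatedZero] at hρ
        cases b with
        | true =>
          refine absurd (fun i hi => ?_) hρ
          have h0 := h i
          have h1 := (List.getElem?_eq_some_iff.1 hi).1
          grind
        | false =>
          obtain ⟨m, rfl⟩ : ∃ m, n = m + 3 := ⟨ρ.length + 1, by simpa using hn.symm⟩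
          obtain ⟨t, rfl⟩ := ih m (by omega) ρ (by simpa using hn) fun i hi => by
            by_contra hcon
            refine hρ fun j hj => ?_
            have h0 := h i
            have h1 := h j
            have h2 := (List.getElem?_eq_some_iff.1 hi).1
            have h3 := (List.getElem?_eq_some_iff.1 hj).1
            grind
          exact ⟨.node t (.node .leaf (.node .leaf .leaf)), by simp [Bracketing.leafWord]⟩

theorem mem_Rset_iff {n : ℕ} (hn : n ≠ 1) (ρ : List Bool) :
    ρ ∈ Rset n ↔ ρ.length = n ∧ NoIsolatedZero ρ := by
  simp only [Rset, Set.mem_ofPred_eq, List.prefix_iff_getElem?, List.suffix_iff_getElem?,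
    List.infix_iff_getElem?, List.length_cons, List.length_nil]
  refine and_congr_right fun hlen => ⟨?_, ?_⟩
  · rintro ⟨h₁, h₂, h₃⟩ i hi
    obtain ⟨hi₀, hi₁⟩ := List.getElem?_eq_some_iff.1 hi
    by_contra! hcon
    obtain ⟨hnext, hprev⟩ := hcon
    have htrue (j : ℕ) (hj : j < ρ.length) (hne : ρ[j]? ≠ some false) : ρ[j]? = some true := by
      rw [List.getElem?_eq_getElem hj] at hne ⊢
      simpa using hne
    have hnext' (h : i + 1 < n) := htrue (i + 1) (by omega) hnext
    have hprev' (j : ℕ) (h : j + 1 = i) := htrue j (by omega) (hprev j h)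
    clear htrue hnext hprev
    rcases i with _ | j
    · refine h₁ fun i h => ?_
      rcases i with _ | _ | i
      exacts [hi, hnext' (by omega), by omega]
    · have hj := hprev' j rfl
      by_cases hlast : j + 2 < n
      · have := hnext' hlast
        refine h₃ ⟨j, by omega, fun i h => ?_⟩
        clear h₁ h₂
        rcases i with _ | _ | _ | i <;> grind
      · refine h₂ ⟨by omega, fun i h => ?_⟩
        clear h₁ h₃
        rcases i with _ | _ | i <;> grind
  · intro h
    refine ⟨fun h₁ => ?_, fun ⟨hl, h₂⟩ => ?_, fun ⟨k, hk, h₃⟩ => ?_⟩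
    · have := h 0
      have := h₁ 0
      have := h₁ 1
      simp_all
    · have := h (ρ.length - 1)
      have := h₂ 0
      have := h₂ 1
      grind
    · have := h (k + 1)
      have := h₃ 0
      have := h₃ 1
      have := h₃ 2
      grind

theorem range_leafWord {n : ℕ} (hn : 3 ≤ n) :
    (Set.range fun t : Bracketing n => t.leafWord) = Rset (n - 1) := by
  ext ρ
  rw [mem_Rset_iff (by omega)]
  constructor
  · rintro ⟨t, rfl⟩
    exact ⟨by have := t.length_leafWord; dsimp only; omega, t.noIsolatedZero_leafWord⟩
  · rintro ⟨hlen, h⟩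
    exact h.exists_leafWord_eq n ρ (by omega)

/-- Proposition 9.3: the associative spectrum of the graph
algebra of the digraph `G0` on `{u, v, w}` with edges `(u,v), (u,w), (w,w)`
satisfies `s_n = |R_{n-1}|` for all `n ≥ 3`. -/
theorem spectrum_of_G0 (n : ℕ) (hn : 3 ≤ n) :
    assocSpectrum E0 n = Nat.card (Rset (n - 1)) := by
  rw [← range_leafWord hn, assocSpectrum]
  refine Nat.card_congr ((Setoid.quotientKerEquivRange _).symm.trans
    ((Quotient.congr (Equiv.refl _) fun t t' => ?_).trans (Setoid.quotientKerEquivRange _)))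
  exact t.eval_eq_iff_leafWord_eq t'
end
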